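/- Weighted Poincaré inequality on hyperbolic space: let n ≥ 2, let A⁰ > 0 and A ∈ ℝⁿ with ‖A‖ ≤ A⁰, and let V(x) = A⁰√(1+‖x‖²) + ∑ᵢ Aⁱxⁱ. Let ĥ be a smooth compactly supported symmetric 2-tensor field on ℝⁿ which is trace-free with respect to the hyperbolic metric ḡ, i.e. ∑_{i,j} ḡ^{ij}(x) ĥ_{ij}(x) = 0 for all x. Then ∫_{ℝⁿ} |ĥ|²_ḡ V dμ ≤ (1/n) ∫_{ℝⁿ} |∇̄ĥ|²_ḡ V dμ, where dμ = (1+‖x‖²)^{−1/2} dx, |ĥ|²_ḡ = ∑ ḡ^{ik}ḡ^{jℓ} ĥ_{ij}ĥ_{kℓ}, and |∇̄ĥ|²_ḡ = ∑ ḡ^{km}ḡ^{ip}ḡ^{jq} ∇̄ₖĥ_{ij} ∇̄ₘĥ_{pq}. -/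

import Mathlib

open Real MeasureTheory

noncomputable section

/-- The `i`-th partial derivative of `f : ℝⁿ → ℝ` at `x`. -/
def pd {n : ℕ} (f : (Fin n → ℝ) → ℝ) (i : Fin n) (x : Fin n → ℝ) : ℝ :=
  fderiv ℝ f x (Pi.single i 1)

/-- Components of the hyperbolic metric on ℝⁿ:
`ḡ_{ij}(x) = δ_{ij} − xᵢxⱼ/(1+‖x‖²)`. -/
def gbar {n : ℕ} (i j : Fin n) (x : Fin n → ℝ) : ℝ :=
  (if i = j then 1 else 0) - x i * x j / (1 + ∑ k, x k ^ 2)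

/-- Components of the inverse hyperbolic metric: `ḡ^{ij}(x) = δ_{ij} + xᵢxⱼ`. -/
def ginv {n : ℕ} (i j : Fin n) (x : Fin n → ℝ) : ℝ :=
  (if i = j then 1 else 0) + x i * x j

/-- Christoffel symbols `Γ̄^k_{ij}` of the hyperbolic metric. -/
def Gam {n : ℕ} (k i j : Fin n) (x : Fin n → ℝ) : ℝ :=
  (1 / 2) * ∑ l, ginv k l x *
    (pd (gbar j l) i x + pd (gbar i l) j x - pd (gbar i j) l x)

/-- The static potential `V(x) = A⁰√(1+‖x‖²) + ∑ᵢ Aⁱxⁱ`. -/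
def Vpot {n : ℕ} (A0 : ℝ) (A : Fin n → ℝ) (x : Fin n → ℝ) : ℝ :=
  A0 * Real.sqrt (1 + ∑ k, x k ^ 2) + ∑ i, A i * x i

/-- The `ḡ`-covariant derivative `∇̄ₖh_{ij}` of a symmetric 2-tensor field on ℝⁿ. -/
def covDh {n : ℕ} (h : Fin n → Fin n → (Fin n → ℝ) → ℝ) (k i j : Fin n)
    (x : Fin n → ℝ) : ℝ :=
  pd (h i j) k x - ∑ l, (Gam l k i x * h l j x + Gam l k j x * h i l x)

/-- `|h|²_ḡ = ∑ ḡ^{ik} ḡ^{jℓ} h_{ij} h_{kℓ}`. -/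
def hNormSq {n : ℕ} (h : Fin n → Fin n → (Fin n → ℝ) → ℝ) (x : Fin n → ℝ) : ℝ :=
  ∑ i, ∑ k, ∑ j, ∑ l, ginv i k x * ginv j l x * h i j x * h k l x

/-- `|∇̄h|²_ḡ = ∑ ḡ^{km} ḡ^{ip} ḡ^{jq} ∇̄ₖh_{ij} ∇̄ₘh_{pq}`. -/
def covDNormSq {n : ℕ} (h : Fin n → Fin n → (Fin n → ℝ) → ℝ) (x : Fin n → ℝ) : ℝ :=
  ∑ k, ∑ m, ∑ i, ∑ p, ∑ j, ∑ q, ginv k m x * ginv i p x * ginv j q x *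
    covDh h k i j x * covDh h m p q x

/-- `(D̄h)_{ijk} := (∇̄ᵢh_{jk} − ∇̄ⱼh_{ik})/√2`. -/
def Dbar {n : ℕ} (h : Fin n → Fin n → (Fin n → ℝ) → ℝ) (i j k : Fin n)
    (x : Fin n → ℝ) : ℝ :=
  (covDh h i j k x - covDh h j i k x) / Real.sqrt 2

/-- `|D̄h|²_ḡ = ∑ ḡ^{ip} ḡ^{jq} ḡ^{kr} (D̄h)_{ijk} (D̄h)_{pqr}`. -/
def DbarNormSq {n : ℕ} (h : Fin n → Fin n → (Fin n → ℝ) → ℝ) (x : Fin n → ℝ) : ℝ :=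
  ∑ i, ∑ p, ∑ j, ∑ q, ∑ k, ∑ r, ginv i p x * ginv j q x * ginv k r x *
    Dbar h i j k x * Dbar h p q r x

/-- `(div̄ h)_j := −∑_{i,k} ḡ^{ik} ∇̄ᵢh_{kj}`. -/
def divBar {n : ℕ} (h : Fin n → Fin n → (Fin n → ℝ) → ℝ) (j : Fin n)
    (x : Fin n → ℝ) : ℝ :=
  -∑ i, ∑ k, ginv i k x * covDh h i k j x

/-- `(h_{dV})_i := V⁻¹ ∑_{j,k} h_{ij} ḡ^{jk} ∂ₖV`. -/
def hdV {n : ℕ} (A0 : ℝ) (A : Fin n → ℝ) (h : Fin n → Fin n → (Fin n → ℝ) → ℝ)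
    (i : Fin n) (x : Fin n → ℝ) : ℝ :=
  (Vpot A0 A x)⁻¹ * ∑ j, ∑ k, h i j x * ginv j k x * pd (Vpot A0 A) k x

/-- `|w|²_ḡ = ∑ ḡ^{ij} wᵢ wⱼ` for a covector field `w`. -/
def covecNormSq {n : ℕ} (w : Fin n → (Fin n → ℝ) → ℝ) (x : Fin n → ℝ) : ℝ :=
  ∑ i, ∑ j, ginv i j x * w i x * w j x

/-- Contraction of a covariant 2-tensor with the position vector. -/
def lowContr {n : ℕ} (x : Fin n → ℝ) (h : Fin n → Fin n → ℝ) (k : Fin n) : ℝ :=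
  ∑ a, x a * h a k

/-- The 2-tensor with its first index raised by the inverse hyperbolic metric at `x`. -/
def mixed {n : ℕ} (x : Fin n → ℝ) (h : Fin n → Fin n → ℝ) (i k : Fin n) : ℝ :=
  h i k + x i * lowContr x h k

/-- Contraction of the second index of the mixed tensor with the position vector. -/
def mixedContr {n : ℕ} (x : Fin n → ℝ) (h : Fin n → Fin n → ℝ) (i : Fin n) : ℝ :=
  ∑ l, mixed x h i l * x l

/-- The 2-tensor with both indices raised by the inverse hyperbolic metric at `x`. -/
def raised {n : ℕ} (x : Fin n → ℝ) (h : Fin n → Fin n → ℝ) (i k : Fin n) : ℝ :=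
  mixed x h i k + mixedContr x h i * x k

section PointwiseAlgebra

variable {n : ℕ} {x : Fin n → ℝ} {h : Fin n → Fin n → ℝ} {κ : ℝ} {g : Fin n → Fin n → ℝ}

lemma mixedContr_eq (hs : ∀ i j, h i j = h j i) (i : Fin n) :
    mixedContr x h i = lowContr x h i + x i * ∑ l, lowContr x h l * x l := by
  simp only [mixedContr, mixed, add_mul, Finset.sum_add_distrib, Finset.mul_sum]
  congr 1
  · exact Finset.sum_congr rfl fun l _ => by rw [hs i l]; ring
  · exact Finset.sum_congr rfl fun l _ => by ring

lemma sum_x_mul_mixed (k : Fin n) :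
    ∑ i, x i * mixed x h i k = (1 + ∑ i, x i ^ 2) * lowContr x h k := by
  simp only [mixed, mul_add, Finset.sum_add_distrib, add_mul, one_mul, Finset.sum_mul]
  congr 1
  exact Finset.sum_congr rfl fun l _ => by ring

lemma kappa_sum_x_mul_mixed (hκ : κ * (1 + ∑ i, x i ^ 2) = 1) (k : Fin n) :
    κ * ∑ i, x i * mixed x h i k = lowContr x h k := by
  rw [sum_x_mul_mixed, ← mul_assoc, hκ, one_mul]

lemma sum_metric_mul (hg : ∀ i j, g i j = (if i = j then 1 else 0) - κ * x i * x j)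
    (y : Fin n → ℝ) (i : Fin n) : ∑ j, g i j * y j = y i - κ * x i * ∑ j, x j * y j := by
  simp only [hg, sub_mul, Finset.sum_sub_distrib, ite_mul, one_mul, zero_mul,
    Finset.sum_ite_eq, Finset.mem_univ, if_true, Finset.mul_sum]
  congr 1
  exact Finset.sum_congr rfl fun l _ => by ring

lemma sum_metric_mul_mixed (hκ : κ * (1 + ∑ i, x i ^ 2) = 1)
    (hg : ∀ i j, g i j = (if i = j then 1 else 0) - κ * x i * x j) (i k : Fin n) :
    ∑ j, g i j * mixed x h j k = h i k := by
  rw [sum_metric_mul hg]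
  have := kappa_sum_x_mul_mixed (h := h) hκ k
  simp only [mixed] at this ⊢
  linear_combination (-x i) * this

lemma sum_x_mul_mixedContr (hs : ∀ i j, h i j = h j i) :
    ∑ i, x i * mixedContr x h i =
      (1 + ∑ i, x i ^ 2) * ∑ l, lowContr x h l * x l := by
  simp only [mixedContr_eq hs, mul_add, Finset.sum_add_distrib, add_mul, one_mul]
  congr 1
  · exact Finset.sum_congr rfl fun l _ => by ring
  · rw [Finset.sum_mul]
    exact Finset.sum_congr rfl fun l _ => by ring

lemma kappa_sum_x_mul_mixedContr (hκ : κ * (1 + ∑ i, x i ^ 2) = 1)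
    (hs : ∀ i j, h i j = h j i) :
    κ * ∑ i, x i * mixedContr x h i = ∑ l, lowContr x h l * x l := by
  rw [sum_x_mul_mixedContr hs, ← mul_assoc, hκ, one_mul]

lemma sum_metric_mul_mixedContr (hκ : κ * (1 + ∑ i, x i ^ 2) = 1)
    (hg : ∀ i j, g i j = (if i = j then 1 else 0) - κ * x i * x j)
    (hs : ∀ i j, h i j = h j i) (i : Fin n) :
    ∑ j, g i j * mixedContr x h j = lowContr x h i := by
  rw [sum_metric_mul hg, mixedContr_eq hs]
  linear_combination (-x i) * kappa_sum_x_mul_mixedContr hκ hs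

lemma kappa_sum_x_mul_raised (hκ : κ * (1 + ∑ i, x i ^ 2) = 1)
    (hs : ∀ i j, h i j = h j i) (k : Fin n) :
    κ * ∑ i, x i * raised x h i k = mixedContr x h k := by
  have e : ∑ i, x i * raised x h i k =
      ∑ i, x i * mixed x h i k + (∑ i, x i * mixedContr x h i) * x k := by
    simp only [raised, mul_add, Finset.sum_add_distrib, Finset.sum_mul, mul_assoc]
  rw [e, mul_add, kappa_sum_x_mul_mixed hκ, ← mul_assoc, kappa_sum_x_mul_mixedContr hκ hs,
    mixedContr_eq hs]
  ring

/-- Contraction of the raised tensor with the metric is the trace. -/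
lemma sum_raised_mul_metric (hκ : κ * (1 + ∑ i, x i ^ 2) = 1)
    (hg : ∀ i j, g i j = (if i = j then 1 else 0) - κ * x i * x j) (j : Fin n) :
    ∑ k, raised x h j k * g j k = mixed x h j j := by
  have := sum_metric_mul hg (fun k => raised x h j k) j
  have e : ∑ k, x k * raised x h j k = (1 + ∑ i, x i ^ 2) * mixedContr x h j := by
    simp only [raised, mul_add, Finset.sum_add_distrib, mixedContr, add_mul, one_mul]
    congr 1
    · exact Finset.sum_congr rfl fun l _ => by ring
    · rw [Finset.sum_mul]
      exact Finset.sum_congr rfl fun l _ => by ring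
  simp only [mul_comm (raised x h j _)]
  rw [this, e]
  simp only [raised]
  linear_combination (-x j * mixedContr x h j) * hκ

/-- Two expressions for the square norm. -/
lemma sum_raised_mul (hs : ∀ i j, h i j = h j i) :
    ∑ j, ∑ k, raised x h j k * h j k = ∑ i, ∑ j, mixed x h i j * mixed x h j i := by
  have e1 : ∀ j, ∑ k, raised x h j k * h j k =
      ∑ k, mixed x h j k * h j k + mixedContr x h j * lowContr x h j := fun j => by
    simp only [raised, add_mul, Finset.sum_add_distrib, lowContr, Finset.mul_sum]
    congr 1
    exact Finset.sum_congr rfl fun l _ => by rw [hs j l]; ring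
  have e2 : ∀ i, ∑ j, mixed x h i j * mixed x h j i =
      ∑ k, mixed x h i k * h i k + mixedContr x h i * lowContr x h i := fun i => by
    rw [mixedContr, Finset.sum_mul, ← Finset.sum_add_distrib]
    refine Finset.sum_congr rfl fun l _ => ?_
    conv_lhs => rw [mixed.eq_def x h l i]
    rw [hs l i]; ring
  simp only [e1, e2]

variable {T P : Fin n → Fin n → Fin n → ℝ}

lemma kappa_sum_x_mul_deriv (hκ : κ * (1 + ∑ i, x i ^ 2) = 1) (hs : ∀ i j, h i j = h j i)
    (hP : ∀ j i k, P j i k = mixed x (T j) i k + x i * h j k - g j k * mixedContr x h i)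
    (j k : Fin n) :
    κ * ∑ i, x i * P j i k = lowContr x (T j) k + (1 - κ) * h j k
      - (∑ l, lowContr x h l * x l) * g j k := by
  have e : ∑ i, x i * P j i k = ∑ i, x i * mixed x (T j) i k
      + (∑ i, x i ^ 2) * h j k - (∑ i, x i * mixedContr x h i) * g j k := by
    simp only [Finset.sum_mul, ← Finset.sum_add_distrib, ← Finset.sum_sub_distrib]
    exact Finset.sum_congr rfl fun i _ => by rw [hP]; ring
  rw [e]
  linear_combination kappa_sum_x_mul_mixed (h := T j) hκ k + h j k * hκ
    - g j k * kappa_sum_x_mul_mixedContr hκ hs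

lemma sum_deriv_mul_x (hg : ∀ i j, g i j = (if i = j then 1 else 0) - κ * x i * x j)
    (hκ : κ * (1 + ∑ i, x i ^ 2) = 1) (hs : ∀ i j, h i j = h j i)
    (hP : ∀ j i k, P j i k = mixed x (T j) i k + x i * h j k - g j k * mixedContr x h i)
    (j i : Fin n) :
    ∑ k, P j i k * x k = mixedContr x (T j) i + x i * lowContr x h j
      - κ * x j * mixedContr x h i := by
  have e : ∑ k, P j i k * x k = mixedContr x (T j) i + x i * lowContr x h j
      - (∑ k, g j k * x k) * mixedContr x h i := by
    rw [mixedContr.eq_def x (T j), lowContr, Finset.mul_sum, Finset.sum_mul,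
      ← Finset.sum_add_distrib, ← Finset.sum_sub_distrib]
    exact Finset.sum_congr rfl fun k _ => by rw [hP, hs j k]; ring
  rw [e, sum_metric_mul hg]
  have : ∑ j, x j * x j = ∑ i, x i ^ 2 := Finset.sum_congr rfl fun l _ => by ring
  rw [this]
  linear_combination (x j * mixedContr x h i) * hκ

lemma kappa_sum_mixed_mul_x_mul (hκ : κ * (1 + ∑ i, x i ^ 2) = 1) (y : Fin n → ℝ) :
    ∑ j, ∑ i, mixed x h j i * (κ * x j * y i) = ∑ i, lowContr x h i * y i := by
  rw [Finset.sum_comm]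
  refine Finset.sum_congr rfl fun i _ => ?_
  rw [← kappa_sum_x_mul_mixed hκ, Finset.mul_sum, Finset.sum_mul]
  exact Finset.sum_congr rfl fun j _ => by ring

/-- The remaining contractions of the derivative with the position vector cancel. -/
lemma sum_mixed_mul_deriv_contr (hg : ∀ i j, g i j = (if i = j then 1 else 0) - κ * x i * x j)
    (hκ : κ * (1 + ∑ i, x i ^ 2) = 1) (hs : ∀ i j, h i j = h j i)
    (hT : ∀ j a k, T j a k = T j k a)
    (hP : ∀ j i k, P j i k = mixed x (T j) i k + x i * h j k - g j k * mixedContr x h i)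
    (htr : ∑ i, mixed x h i i = 0) :
    ∑ j, ∑ i, mixed x h j i * ∑ k, P j i k * x k
      = κ * ∑ i, x i * ∑ j, ∑ k, raised x h j k * P j i k
        - (1 - κ) * ∑ i, ∑ j, mixed x h i j * mixed x h j i := by
  have e1 : κ * ∑ i, x i * ∑ j, ∑ k, raised x h j k * P j i k =
      ∑ j, ∑ k, raised x h j k * (κ * ∑ i, x i * P j i k) := by
    simp only [Finset.mul_sum]
    rw [Finset.sum_comm]
    refine Finset.sum_congr rfl fun j _ => ?_
    rw [Finset.sum_comm]
    exact Finset.sum_congr rfl fun k _ => Finset.sum_congr rfl fun i _ => by ring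
  have e2 : ∑ j, ∑ k, raised x h j k * (κ * ∑ i, x i * P j i k) =
      ∑ j, ∑ k, raised x h j k * lowContr x (T j) k
      + (1 - κ) * ∑ j, ∑ k, raised x h j k * h j k
      - (∑ l, lowContr x h l * x l) * ∑ j, ∑ k, raised x h j k * g j k := by
    simp only [kappa_sum_x_mul_deriv hκ hs hP, Finset.mul_sum, ← Finset.sum_add_distrib,
      ← Finset.sum_sub_distrib]
    exact Finset.sum_congr rfl fun j _ => Finset.sum_congr rfl fun k _ => by ring
  have e3 : ∑ j, ∑ i, mixed x h j i * ∑ k, P j i k * x k =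
      ∑ j, ∑ i, mixed x h j i * mixedContr x (T j) i
      + ∑ j, (∑ i, mixed x h j i * x i) * lowContr x h j
      - ∑ j, ∑ i, mixed x h j i * (κ * x j * mixedContr x h i) := by
    simp only [sum_deriv_mul_x hg hκ hs hP, Finset.sum_mul, ← Finset.sum_add_distrib,
      ← Finset.sum_sub_distrib]
    exact Finset.sum_congr rfl fun j _ => Finset.sum_congr rfl fun k _ => by ring
  have e4 : ∀ j, ∑ i, mixed x h j i * mixedContr x (T j) i =
      ∑ k, raised x h j k * lowContr x (T j) k := fun j => by
    simp only [mixedContr_eq (hT j), raised, mul_add, add_mul, Finset.sum_add_distrib]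
    congr 1
    simp only [← mul_assoc]
    rw [← Finset.sum_mul]
    change mixedContr x h j * _ = _
    rw [Finset.mul_sum]
    exact Finset.sum_congr rfl fun j _ => by ring
  rw [e1, e2, e3, kappa_sum_mixed_mul_x_mul hκ, sum_raised_mul hs]
  simp only [e4, sum_raised_mul_metric hκ hg, htr]
  have e5 : ∑ j, (∑ i, mixed x h j i * x i) * lowContr x h j =
      ∑ i, lowContr x h i * mixedContr x h i :=
    Finset.sum_congr rfl fun j _ => by rw [mixedContr]; ring
  rw [e5]
  ring

/-- The derivative part of the gradient of the square norm. -/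
lemma sum_deriv_mul_mixed (hg : ∀ i j, g i j = (if i = j then 1 else 0) - κ * x i * x j)
    (hκ : κ * (1 + ∑ i, x i ^ 2) = 1) (hs : ∀ i j, h i j = h j i)
    (hP : ∀ j i k, P j i k = mixed x (T j) i k + x i * h j k - g j k * mixedContr x h i)
    (i : Fin n) :
    ∑ j, ∑ k, P i j k * mixed x h k j =
      ∑ j, ∑ k, mixed x (T i) j k * h j k
        + ∑ j, mixedContr x (T i) j * lowContr x h j := by
  have e1 : ∑ j, ∑ k, P i j k * mixed x h k j =
      ∑ j, ∑ k, mixed x (T i) j k * mixed x h k j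
      + ∑ k, h i k * (∑ j, mixed x h k j * x j)
      - ∑ j, (∑ k, g i k * mixed x h k j) * mixedContr x h j := by
    have : ∑ k, h i k * (∑ j, mixed x h k j * x j) =
        ∑ j, ∑ k, h i k * (mixed x h k j * x j) := by
      rw [Finset.sum_comm]; simp only [Finset.mul_sum]
    rw [this]
    simp only [Finset.sum_mul, ← Finset.sum_add_distrib, ← Finset.sum_sub_distrib]
    exact Finset.sum_congr rfl fun j _ => Finset.sum_congr rfl fun k _ => by rw [hP]; ring
  have e2 : ∑ j, ∑ k, mixed x (T i) j k * mixed x h k j =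
      ∑ j, ∑ k, mixed x (T i) j k * h j k
        + ∑ j, mixedContr x (T i) j * lowContr x h j := by
    simp only [mixedContr, Finset.sum_mul, ← Finset.sum_add_distrib]
    refine Finset.sum_congr rfl fun j _ => Finset.sum_congr rfl fun k _ => ?_
    rw [mixed.eq_def x h k j, hs k j]; ring
  simp only [sum_metric_mul_mixed hκ hg] at e1
  rw [e1, e2]
  simp only [mixedContr]
  ring

lemma sum_metric_mul_metric (hg : ∀ i j, g i j = (if i = j then 1 else 0) - κ * x i * x j)
    (hκ : κ * (1 + ∑ i, x i ^ 2) = 1) (i j : Fin n) :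
    ∑ k, g i k * g j k = g i j - κ ^ 2 * x i * x j := by
  rw [sum_metric_mul hg]
  have : ∑ k, x k * g j k = κ * x j := by
    simp only [mul_comm (x _) (g _ _)]
    rw [sum_metric_mul hg]
    have : ∑ j, x j * x j = ∑ i, x i ^ 2 := Finset.sum_congr rfl fun l _ => by ring
    rw [this]
    linear_combination (-x j) * hκ
  rw [this, hg j i, hg i j]
  simp only [eq_comm]
  ring

/-- The Christoffel corrections contribute nothing quadratic in the tensor. -/
lemma sum_christoffel_quadratic (hg : ∀ i j, g i j = (if i = j then 1 else 0) - κ * x i * x j)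
    (hκ : κ * (1 + ∑ i, x i ^ 2) = 1) (hs : ∀ i j, h i j = h j i) :
    ∑ i, ∑ j, ((∑ k, (x j * h i k - g i k * mixedContr x h j)
          * (x i * h j k - g j k * mixedContr x h i))
        + (x j * lowContr x h i - κ * x i * mixedContr x h j)
          * (x i * lowContr x h j - κ * x j * mixedContr x h i)) = 0 := by
  set u := mixedContr x h with hu
  set w := lowContr x h with hw
  have hgh : ∀ i j, ∑ k, g j k * h i k = h i j - κ * x j * w i := fun i j => by
    rw [sum_metric_mul hg, hw, lowContr]
    simp only [hs i]
  have e1 : ∀ i j, ((∑ k, (x j * h i k - g i k * u j) * (x i * h j k - g j k * u i))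
        + (x j * w i - κ * x i * u j) * (x i * w j - κ * x j * u i)) =
      (∑ k, (x i * h i k) * (x j * h j k)) - u i * (x j * h j i) - u j * (x i * h i j)
        + u i * (g i j * u j) + (w i * x i) * (w j * x j) := fun i j => by
    have : ∑ k, (x j * h i k - g i k * u j) * (x i * h j k - g j k * u i) =
        (∑ k, (x i * h i k) * (x j * h j k)) - x j * u i * (∑ k, g j k * h i k)
        - x i * u j * (∑ k, g i k * h j k) + u i * u j * ∑ k, g i k * g j k := by
      simp only [Finset.mul_sum, ← Finset.sum_add_distrib, ← Finset.sum_sub_distrib]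
      exact Finset.sum_congr rfl fun k _ => by ring
    rw [this, hgh, hgh, sum_metric_mul_metric hg hκ, hs j i]
    ring
  simp only [e1, Finset.sum_add_distrib, Finset.sum_sub_distrib]
  have f1 : ∑ i, ∑ j, ∑ k, (x i * h i k) * (x j * h j k) = ∑ k, w k * w k := by
    simp only [hw, lowContr, Finset.sum_mul_sum]
    rw [Finset.sum_comm]
    conv_rhs => rw [Finset.sum_comm]
    rw [Finset.sum_comm]
    refine Finset.sum_congr rfl fun i _ => ?_
    rw [Finset.sum_comm]
  have f2 : ∑ i, ∑ j, u i * (x j * h j i) = ∑ k, u k * w k := by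
    simp only [← Finset.mul_sum]; rfl
  have f3 : ∑ i, ∑ j, u j * (x i * h i j) = ∑ k, u k * w k := by
    rw [Finset.sum_comm]; exact f2
  have f4 : ∑ i, ∑ j, u i * (g i j * u j) = ∑ k, u k * w k := by
    simp only [← Finset.mul_sum, hu, sum_metric_mul_mixedContr hκ hg hs]; rfl
  have f5 : ∑ i, ∑ j, (w i * x i) * (w j * x j) = (∑ i, w i * x i) * ∑ i, w i * x i := by
    rw [Finset.sum_mul_sum]
  have f6 : ∑ k, u k * w k = ∑ k, w k * w k + (∑ i, w i * x i) * ∑ i, w i * x i := by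
    rw [Finset.sum_mul, ← Finset.sum_add_distrib]
    refine Finset.sum_congr rfl fun k _ => ?_
    rw [hu, mixedContr_eq hs]; ring
  rw [f1, f2, f3, f4, f5, f6]
  ring

lemma sum_mixed_mul_metric (hg : ∀ i j, g i j = (if i = j then 1 else 0) - κ * x i * x j)
    (S : Fin n → Fin n → ℝ) (htr : ∑ j, mixed x S j j = 0) :
    ∑ j, ((∑ k, mixed x S j k * g j k) + κ * mixedContr x S j * x j) = 0 := by
  rw [← htr]
  refine Finset.sum_congr rfl fun j _ => ?_
  simp only [mul_comm _ (g _ _)]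
  rw [sum_metric_mul hg, mixedContr]
  simp only [mul_comm (x _) (mixed x S _ _)]
  ring

/-- The transposed square of the covariant derivative in terms of partial derivatives. -/
lemma sum_deriv_mul_deriv (hg : ∀ i j, g i j = (if i = j then 1 else 0) - κ * x i * x j)
    (hκ : κ * (1 + ∑ i, x i ^ 2) = 1) (hs : ∀ i j, h i j = h j i)
    (hP : ∀ j i k, P j i k = mixed x (T j) i k + x i * h j k - g j k * mixedContr x h i)
    (htrT : ∀ i, ∑ j, mixed x (T i) j j = 0) :
    ∑ i, ∑ j, ((∑ k, P i j k * P j i k) + (∑ k, P i j k * x k) * ∑ k, P j i k * x k) =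
      ∑ i, ∑ j, ((∑ k, mixed x (T i) j k * mixed x (T j) i k)
          + mixedContr x (T i) j * mixedContr x (T j) i)
        + 2 * ∑ i, x i * ∑ j, ∑ k, P i j k * mixed x h k j := by
  have hc : ∀ i j, (∑ k, P i j k * P j i k) + (∑ k, P i j k * x k) * ∑ k, P j i k * x k =
      ((∑ k, mixed x (T i) j k * mixed x (T j) i k)
          + mixedContr x (T i) j * mixedContr x (T j) i)
      + ((∑ k, mixed x (T i) j k * (x i * h j k - g j k * mixedContr x h i))
        + mixedContr x (T i) j * (x i * lowContr x h j - κ * x j * mixedContr x h i))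
      + ((∑ k, mixed x (T j) i k * (x j * h i k - g i k * mixedContr x h j))
        + mixedContr x (T j) i * (x j * lowContr x h i - κ * x i * mixedContr x h j))
      + ((∑ k, (x j * h i k - g i k * mixedContr x h j)
          * (x i * h j k - g j k * mixedContr x h i))
        + (x j * lowContr x h i - κ * x i * mixedContr x h j)
          * (x i * lowContr x h j - κ * x j * mixedContr x h i)) := fun i j => by
    have : ∑ k, P i j k * P j i k = (∑ k, mixed x (T i) j k * mixed x (T j) i k)
        + (∑ k, mixed x (T i) j k * (x i * h j k - g j k * mixedContr x h i))
        + (∑ k, mixed x (T j) i k * (x j * h i k - g i k * mixedContr x h j))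
        + ∑ k, (x j * h i k - g i k * mixedContr x h j)
          * (x i * h j k - g j k * mixedContr x h i) := by
      simp only [← Finset.sum_add_distrib]
      exact Finset.sum_congr rfl fun k _ => by rw [hP, hP]; ring
    rw [this, sum_deriv_mul_x hg hκ hs hP, sum_deriv_mul_x hg hκ hs hP]
    ring
  have hx : ∑ i, ∑ j, ((∑ k, mixed x (T i) j k * (x i * h j k - g j k * mixedContr x h i))
        + mixedContr x (T i) j * (x i * lowContr x h j - κ * x j * mixedContr x h i)) =
      ∑ i, x i * ∑ j, ∑ k, P i j k * mixed x h k j := by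
    refine Finset.sum_congr rfl fun i _ => ?_
    have e : ∑ j, ((∑ k, mixed x (T i) j k * (x i * h j k - g j k * mixedContr x h i))
        + mixedContr x (T i) j * (x i * lowContr x h j - κ * x j * mixedContr x h i)) =
        x i * (∑ j, ∑ k, mixed x (T i) j k * h j k
          + ∑ j, mixedContr x (T i) j * lowContr x h j)
        - mixedContr x h i * ∑ j, ((∑ k, mixed x (T i) j k * g j k)
          + κ * mixedContr x (T i) j * x j) := by
      rw [← Finset.sum_add_distrib, Finset.mul_sum, Finset.mul_sum, ← Finset.sum_sub_distrib]
      refine Finset.sum_congr rfl fun j _ => ?_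
      have : ∑ k, mixed x (T i) j k * (x i * h j k - g j k * mixedContr x h i) =
          x i * ∑ k, mixed x (T i) j k * h j k
            - mixedContr x h i * ∑ k, mixed x (T i) j k * g j k := by
        simp only [Finset.mul_sum, ← Finset.sum_sub_distrib]
        exact Finset.sum_congr rfl fun k _ => by ring
      rw [this]; ring
    rw [e, sum_mixed_mul_metric hg _ (htrT i), sum_deriv_mul_mixed hg hκ hs hP]
    ring
  simp only [hc]
  rw [Finset.sum_congr rfl fun i _ => Finset.sum_add_distrib, Finset.sum_add_distrib,
    sum_christoffel_quadratic hg hκ hs,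
    Finset.sum_congr rfl fun i _ => Finset.sum_add_distrib, Finset.sum_add_distrib,
    Finset.sum_congr rfl fun i _ => Finset.sum_add_distrib, Finset.sum_add_distrib, hx,
    Finset.sum_comm (f := fun i j => (∑ k, mixed x (T j) i k *
      (x j * h i k - g i k * mixedContr x h j))
        + mixedContr x (T j) i * (x j * lowContr x h i - κ * x i * mixedContr x h j)), hx]
  ring

variable {dH : Fin n → Fin n → Fin n → ℝ}

lemma sum_deriv_raised_mul_deriv
    (hdH : ∀ i j k, dH i j k = P i j k + (mixed x h j i + ∑ l, P i j l * x l) * x k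
      + mixedContr x h j * if i = k then 1 else 0)
    (htrP : ∀ j, ∑ i, P j i i = 0) :
    ∑ i, ∑ j, ∑ k, dH i j k * P j i k =
      ∑ i, ∑ j, ((∑ k, P i j k * P j i k) + (∑ k, P i j k * x k) * ∑ k, P j i k * x k)
      + ∑ j, ∑ i, mixed x h j i * ∑ k, P j i k * x k := by
  have e : ∀ i j, ∑ k, dH i j k * P j i k =
      ((∑ k, P i j k * P j i k) + (∑ k, P i j k * x k) * ∑ k, P j i k * x k)
      + mixed x h j i * (∑ k, P j i k * x k) + mixedContr x h j * P j i i := fun i j => by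
    have : ∑ k, mixedContr x h j * (if i = k then 1 else 0) * P j i k =
        mixedContr x h j * P j i i := by simp
    rw [← this]
    simp only [add_assoc, ← add_mul, Finset.mul_sum, ← Finset.sum_add_distrib]
    refine Finset.sum_congr rfl fun k _ => ?_
    rw [hdH]; ring
  simp only [e, Finset.sum_add_distrib]
  have z : ∑ i, ∑ j, mixedContr x h j * P j i i = 0 := by
    rw [Finset.sum_comm]
    simp [← Finset.mul_sum, htrP]
  rw [z, add_zero, Finset.sum_comm (f := fun i j => mixed x h j i * _)]

lemma sum_deriv_raised
    (hdH : ∀ i j k, dH i j k = P i j k + (mixed x h j i + ∑ l, P i j l * x l) * x k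
      + mixedContr x h j * if i = k then 1 else 0)
    (htr : ∑ i, mixed x h i i = 0) (k : Fin n) :
    ∑ i, dH i i k = ∑ j, P j j k + (∑ l, (∑ j, P j j l) * x l) * x k + mixedContr x h k := by
  have : ∑ l, (∑ j, P j j l) * x l = ∑ i, ∑ l, P i i l * x l := by
    rw [Finset.sum_comm]; simp only [Finset.sum_mul]
  simp only [hdH, Finset.sum_add_distrib, ← Finset.sum_mul, htr, this]
  simp

/-- The pointwise identity underlying the integrated Weitzenböck formula. -/
lemma weitzenbock_pointwise
    (hg : ∀ i j, g i j = (if i = j then 1 else 0) - κ * x i * x j)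
    (hκ : κ * (1 + ∑ i, x i ^ 2) = 1) (hs : ∀ i j, h i j = h j i)
    (hT : ∀ j a k, T j a k = T j k a)
    (hP : ∀ j i k, P j i k = mixed x (T j) i k + x i * h j k - g j k * mixedContr x h i)
    (htr : ∑ i, mixed x h i i = 0) (htrP : ∀ j, ∑ i, P j i i = 0)
    (hdH : ∀ i j k, dH i j k = P i j k + (mixed x h j i + ∑ l, P i j l * x l) * x k
      + mixedContr x h j * if i = k then 1 else 0)
    {dN : Fin n → ℝ}
    (hdN : ∀ i, dN i = ∑ a, ∑ b, (P i a b * mixed x h b a + mixed x h a b * P i b a))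
    {N : ℝ} (hN : N = ∑ i, ∑ j, mixed x h i j * mixed x h j i)
    {f B : ℝ} {φ : Fin n → ℝ} (hB : B = f - ∑ i, x i * φ i) :
    (f * (∑ i, ∑ j, ∑ k, dH i j k * P j i k - ∑ k, (∑ i, dH i i k) * ∑ j, P j j k)
      + ∑ i, (φ i - κ * f * x i) *
          (∑ j, ∑ k, raised x h j k * P j i k - ∑ k, raised x h i k * ∑ j, P j j k))
      - ∑ i, ((φ i - κ * f * x i) * N * x i + f * dN i * x i + f * N
          + ∑ j, ∑ k, ((dH i i k * mixed x h j k + raised x h i k * P i j k) * φ j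
            + raised x h i k * mixed x h j k * (B * g i j - κ * x i * φ j)))
    = f * (∑ i, ∑ j, ((∑ k, mixed x (T i) j k * mixed x (T j) i k)
            + mixedContr x (T i) j * mixedContr x (T j) i)
          - (∑ k, (∑ j, P j j k) ^ 2 + (∑ k, (∑ j, P j j k) * x k) ^ 2))
      - (n + 1) * f * N
      - 2 * ∑ i, φ i * ∑ k, raised x h i k * ∑ j, P j j k := by
  have htrT : ∀ i, ∑ j, mixed x (T i) j j = 0 := fun i => by
    have := htrP i
    simp only [hP, Finset.sum_add_distrib, Finset.sum_sub_distrib,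
      sum_metric_mul_mixedContr hκ hg hs, hs i] at this
    rw [← this, lowContr]; ring
  set δ : Fin n → ℝ := fun k => ∑ j, P j j k with hδ
  have hδk : ∀ k, ∑ j, P j j k = δ k := fun k => rfl
  simp only [hδk]
  set uδ := ∑ k, mixedContr x h k * δ k with huδ
  set φHδ := ∑ i, φ i * ∑ k, raised x h i k * δ k with hφHδ
  set φHP := ∑ i, φ i * ∑ j, ∑ k, raised x h j k * P j i k with hφHP
  set xHP := ∑ i, x i * ∑ j, ∑ k, raised x h j k * P j i k with hxHP
  set φMu := ∑ j, φ j * ∑ k, mixed x h j k * mixedContr x h k with hφMu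
  have A1 := sum_deriv_raised_mul_deriv hdH htrP
  have A2 : ∑ k, (∑ i, dH i i k) * δ k =
      ∑ k, δ k ^ 2 + (∑ k, δ k * x k) ^ 2 + uδ := by
    simp only [sum_deriv_raised hdH htr, hδk]
    rw [sq (∑ k, δ k * x k), Finset.mul_sum, huδ, ← Finset.sum_add_distrib,
      ← Finset.sum_add_distrib]
    exact Finset.sum_congr rfl fun k _ => by ring
  have A3 : κ * ∑ i, x i * ∑ k, raised x h i k * δ k = uδ := by
    rw [huδ]
    simp only [← kappa_sum_x_mul_raised hκ hs, Finset.mul_sum, Finset.sum_mul]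
    rw [Finset.sum_comm]
    exact Finset.sum_congr rfl fun k _ => Finset.sum_congr rfl fun i _ => by ring
  have A4 : ∀ i, dN i = 2 * ∑ j, ∑ k, P i j k * mixed x h k j := fun i => by
    rw [hdN]
    simp only [Finset.sum_add_distrib]
    rw [two_mul]
    congr 1
    rw [Finset.sum_comm]
    exact Finset.sum_congr rfl fun k _ => Finset.sum_congr rfl fun i _ => by ring
  have A5 : ∑ i, ∑ j, ∑ k, dH i i k * mixed x h j k * φ j = φHδ + φMu := by
    rw [Finset.sum_comm, hφHδ, hφMu, ← Finset.sum_add_distrib]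
    refine Finset.sum_congr rfl fun j _ => ?_
    rw [Finset.sum_comm]
    have : ∀ k, ∑ i, dH i i k * mixed x h j k * φ j =
        φ j * (mixed x h j k * δ k) + φ j * (∑ l, δ l * x l) * (mixed x h j k * x k)
          + φ j * (mixed x h j k * mixedContr x h k) := fun k => by
      simp only [← Finset.sum_mul]
      rw [sum_deriv_raised hdH htr]
      simp only [hδk]
      ring
    simp only [this, Finset.sum_add_distrib, ← Finset.mul_sum]
    have h2 : ∑ k, raised x h j k * δ k =
        ∑ k, mixed x h j k * δ k + mixedContr x h j * ∑ l, δ l * x l := by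
      rw [Finset.mul_sum, ← Finset.sum_add_distrib]
      exact Finset.sum_congr rfl fun k _ => by rw [raised]; ring
    rw [h2]
    change _ + φ j * _ * mixedContr x h j + _ = _
    ring
  have A6 : ∑ i, ∑ j, ∑ k, raised x h i k * P i j k * φ j = φHP := by
    rw [Finset.sum_comm, hφHP]
    simp only [Finset.mul_sum]
    exact Finset.sum_congr rfl fun k _ => Finset.sum_congr rfl fun i _ =>
      Finset.sum_congr rfl fun j _ => by ring
  have A7 : ∑ i, ∑ j, ∑ k, raised x h i k * mixed x h j k * (B * g i j) = B * N := by
    rw [hN, ← sum_raised_mul hs, Finset.mul_sum]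
    refine Finset.sum_congr rfl fun i _ => ?_
    rw [Finset.sum_comm, Finset.mul_sum]
    refine Finset.sum_congr rfl fun k _ => ?_
    rw [← sum_metric_mul_mixed (h := h) hκ hg, Finset.mul_sum, Finset.mul_sum]
    exact Finset.sum_congr rfl fun k _ => by ring
  have A8 : ∑ i, ∑ j, ∑ k, raised x h i k * mixed x h j k * (κ * x i * φ j) = φMu := by
    rw [Finset.sum_comm, hφMu]
    refine Finset.sum_congr rfl fun j _ => ?_
    rw [Finset.sum_comm, Finset.mul_sum]
    refine Finset.sum_congr rfl fun k _ => ?_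
    rw [← kappa_sum_x_mul_raised hκ hs, Finset.mul_sum, Finset.mul_sum, Finset.mul_sum]
    exact Finset.sum_congr rfl fun k _ => by ring
  have D1 : ∑ i, (φ i - κ * f * x i) *
          (∑ j, ∑ k, raised x h j k * P j i k - ∑ k, raised x h i k * δ k) =
      φHP - φHδ - f * (κ * xHP) + f * uδ := by
    rw [← A3]
    have gen : ∀ a b : Fin n → ℝ, ∑ i, (φ i - κ * f * x i) * (a i - b i) =
        ∑ i, φ i * a i - ∑ i, φ i * b i - f * (κ * ∑ i, x i * a i)
          + f * (κ * ∑ i, x i * b i) := fun a b => by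
      simp only [Finset.mul_sum, ← Finset.sum_add_distrib, ← Finset.sum_sub_distrib]
      exact Finset.sum_congr rfl fun k _ => by ring
    exact gen _ _
  have D2 : ∑ i, ((φ i - κ * f * x i) * N * x i + f * dN i * x i + f * N
          + ∑ j, ∑ k, ((dH i i k * mixed x h j k + raised x h i k * P i j k) * φ j
            + raised x h i k * mixed x h j k * (B * g i j - κ * x i * φ j))) =
      N * (∑ i, x i * φ i) - κ * f * N * (∑ i, x i ^ 2)
        + f * (2 * ∑ i, x i * ∑ j, ∑ k, P i j k * mixed x h k j) + n * (f * N)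
        + (φHδ + φMu + φHP + B * N - φMu) := by
    conv_rhs => rw [← A5, ← A6, ← A7]
    rw [← A8]
    have gen : ∀ a b c d e : Fin n → ℝ, ∑ i, ((φ i - κ * f * x i) * N * x i
          + f * (2 * a i) * x i + f * N + (b i + c i + d i - e i)) =
        N * (∑ i, x i * φ i) - κ * f * N * (∑ i, x i ^ 2) + f * (2 * ∑ i, x i * a i)
          + n * (f * N) + (∑ i, b i + ∑ i, c i + ∑ i, d i - ∑ i, e i) := fun a b c d e => by
      have hn : (n : ℝ) * (f * N) = ∑ _i : Fin n, f * N := by simp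
      rw [hn]
      simp only [Finset.mul_sum, ← Finset.sum_add_distrib, ← Finset.sum_sub_distrib]
      exact Finset.sum_congr rfl fun k _ => by ring
    rw [← gen]
    refine Finset.sum_congr rfl fun i _ => ?_
    rw [A4]
    congr 1
    simp only [← Finset.sum_add_distrib, ← Finset.sum_sub_distrib]
    exact Finset.sum_congr rfl fun k _ => Finset.sum_congr rfl fun i _ => by ring
  rw [D1, D2, A1, A2, sum_mixed_mul_deriv_contr hg hκ hs hT hP htr, ← hN,
    sum_deriv_mul_deriv hg hκ hs hP htrT, hB]
  linear_combination (f * N) * hκ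

end PointwiseAlgebra

section Frame

variable {n : ℕ}

/-- A tight frame for the inverse hyperbolic metric: `ḡ^{ij} = ∑_c frame c i * frame c j`. -/
def frame (x : Fin n → ℝ) (c : Option (Fin n)) (i : Fin n) : ℝ :=
  c.elim (x i) fun a => if a = i then 1 else 0

/-- Components of a 2-tensor in the tight frame. -/
def frameComp (x : Fin n → ℝ) (h : Fin n → Fin n → ℝ) (c d : Option (Fin n)) : ℝ :=
  ∑ i, frame x c i * ∑ j, frame x d j * h i j

/-- The square norm of a 2-tensor, computed in the tight frame. -/
def frameNormSq (x : Fin n → ℝ) (h : Fin n → Fin n → ℝ) : ℝ :=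
  ∑ c, ∑ d, frameComp x h c d ^ 2

variable (x : Fin n → ℝ)

lemma sum_frame_mul (X : Option (Fin n) → ℝ) (i : Fin n) :
    ∑ c, frame x c i * X c = X (some i) + x i * X none := by
  simp [Fintype.sum_option, frame, add_comm]

lemma frame_some_sum (a : Fin n) (y : Fin n → ℝ) : ∑ i, frame x (some a) i * y i = y a := by
  simp [frame]

lemma frame_none_sum (y : Fin n → ℝ) : ∑ i, frame x none i * y i = ∑ i, x i * y i := by
  simp [frame]

lemma ginv_eq_sum_frame (i j : Fin n) : ginv i j x = ∑ c, frame x c i * frame x c j := by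
  rw [sum_frame_mul]; simp [ginv, frame, eq_comm]

lemma sum_ginv_mul (X Y : Fin n → ℝ) :
    ∑ i, ∑ j, ginv i j x * X i * Y j =
      ∑ c, (∑ i, frame x c i * X i) * ∑ j, frame x c j * Y j := by
  simp only [ginv_eq_sum_frame, Finset.sum_mul]
  rw [Finset.sum_comm]
  conv_rhs => rw [Finset.sum_comm]
  rw [Finset.sum_comm]
  refine Finset.sum_congr rfl fun i _ => ?_
  rw [Finset.sum_comm]
  refine Finset.sum_congr rfl fun c _ => ?_
  rw [Finset.mul_sum]
  exact Finset.sum_congr rfl fun j _ => by ring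

lemma raise_eq_sum_frame (Y : Fin n → ℝ) (k : Fin n) :
    Y k + (∑ l, Y l * x l) * x k = ∑ c, frame x c k * ∑ l, frame x c l * Y l := by
  rw [sum_frame_mul, frame_some_sum, frame_none_sum]
  simp only [mul_comm (x _) (Y _)]
  ring

lemma sum_ginv_ginv_mul (h : Fin n → Fin n → ℝ) :
    ∑ i, ∑ k, ∑ j, ∑ l, ginv i k x * ginv j l x * h i j * h k l = frameNormSq x h := by
  have e : ∀ i k, ∑ j, ∑ l, ginv i k x * ginv j l x * h i j * h k l =
      ∑ d, ginv i k x * (∑ j, frame x d j * h i j) * ∑ l, frame x d l * h k l := fun i k => by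
    simp only [mul_assoc (ginv i k x), ← Finset.mul_sum, ← sum_ginv_mul]
  simp only [e, frameNormSq]
  rw [Finset.sum_congr rfl fun i _ => Finset.sum_comm, Finset.sum_comm]
  conv_rhs => rw [Finset.sum_comm]
  refine Finset.sum_congr rfl fun d _ => ?_
  rw [sum_ginv_mul]
  exact Finset.sum_congr rfl fun c _ => by rw [frameComp]; ring

lemma mixed_eq_sum_frame (h : Fin n → Fin n → ℝ) (i k : Fin n) :
    mixed x h i k = ∑ c, frame x c i * ∑ b, frame x c b * h b k := by
  rw [sum_frame_mul, frame_some_sum, frame_none_sum]; rfl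

/-- The trace of the square of an endomorphism, in the tight frame. -/
lemma trace_sq_eq_sum_frame (A : Fin n → Fin n → ℝ) :
    ∑ i, ∑ j, (∑ c, frame x c j * ∑ b, frame x c b * A i b)
        * (∑ c, frame x c i * ∑ b, frame x c b * A j b) =
      ∑ c, ∑ d, frameComp x A c d * frameComp x A d c := by
  have e : ∀ i j, (∑ c, frame x c j * ∑ b, frame x c b * A i b)
        * (∑ c, frame x c i * ∑ b, frame x c b * A j b) =
      ∑ d, ∑ c, (frame x c i * ∑ b, frame x d b * A i b)
        * (frame x d j * ∑ b, frame x c b * A j b) := fun i j => by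
    rw [Finset.sum_mul_sum]
    exact Finset.sum_congr rfl fun k _ => Finset.sum_congr rfl fun i _ => by ring
  simp only [e]
  have e2 : ∀ i, ∑ j, ∑ d, ∑ c, (frame x c i * ∑ b, frame x d b * A i b)
        * (frame x d j * ∑ b, frame x c b * A j b) =
      ∑ d, ∑ c, (frame x c i * ∑ b, frame x d b * A i b) * frameComp x A d c := fun i => by
    rw [Finset.sum_comm]
    refine Finset.sum_congr rfl fun d _ => ?_
    rw [Finset.sum_comm]
    exact Finset.sum_congr rfl fun d _ => by rw [← Finset.mul_sum]; rfl
  simp only [e2]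
  rw [Finset.sum_comm]
  conv_rhs => rw [Finset.sum_comm]
  refine Finset.sum_congr rfl fun d _ => ?_
  rw [Finset.sum_comm]
  exact Finset.sum_congr rfl fun d _ => by rw [← Finset.sum_mul]; rfl

lemma trace_sq_le_frameNormSq (A : Fin n → Fin n → ℝ) :
    ∑ c, ∑ d, frameComp x A c d * frameComp x A d c ≤ frameNormSq x A := by
  have e : ∑ c, ∑ d, frameComp x A d c ^ 2 = frameNormSq x A := Finset.sum_comm
  have : 0 ≤ ∑ c, ∑ d, (frameComp x A c d - frameComp x A d c) ^ 2 := by positivity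
  have e2 : ∑ c, ∑ d, (frameComp x A c d - frameComp x A d c) ^ 2 =
      frameNormSq x A + ∑ c, ∑ d, frameComp x A d c ^ 2
        - 2 * ∑ c, ∑ d, frameComp x A c d * frameComp x A d c := by
    simp only [frameNormSq, Finset.mul_sum, ← Finset.sum_add_distrib, ← Finset.sum_sub_distrib]
    exact Finset.sum_congr rfl fun k _ => Finset.sum_congr rfl fun i _ => by ring
  rw [e2, e] at this
  linarith

lemma frameComp_symm {h : Fin n → Fin n → ℝ} (hs : ∀ i j, h i j = h j i)
    (c d : Option (Fin n)) : frameComp x h c d = frameComp x h d c := by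
  simp only [frameComp, Finset.mul_sum]
  rw [Finset.sum_comm]
  exact Finset.sum_congr rfl fun k _ => Finset.sum_congr rfl fun i _ => by
    rw [hs i k]; ring

lemma sum_mixed_mul_mixed {h : Fin n → Fin n → ℝ} (hs : ∀ i j, h i j = h j i) :
    ∑ i, ∑ j, mixed x h i j * mixed x h j i = frameNormSq x h := by
  have e : ∀ i j, mixed x h i j * mixed x h j i =
      (∑ c, frame x c j * ∑ b, frame x c b * h i b)
        * (∑ c, frame x c i * ∑ b, frame x c b * h j b) := fun i j => by
    rw [mixed_eq_sum_frame, mixed_eq_sum_frame, mul_comm]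
    simp only [fun b => hs b i, fun b => hs b j]
  simp only [e, trace_sq_eq_sum_frame, frameNormSq]
  exact Finset.sum_congr rfl fun c _ => Finset.sum_congr rfl fun d _ => by
    rw [frameComp_symm x hs d c, sq]

/-- The transposed square of a 3-tensor is at most its square norm. -/
lemma transposed_square_le (T : Fin n → Fin n → Fin n → ℝ) :
    ∑ i, ∑ j, ((∑ k, mixed x (T i) j k * mixed x (T j) i k)
        + mixedContr x (T i) j * mixedContr x (T j) i) ≤
      ∑ k, ∑ m, ∑ i, ∑ p, ∑ j, ∑ q, ginv k m x * ginv i p x * ginv j q x *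
        T k i j * T m p q := by
  set S : Option (Fin n) → Fin n → Fin n → ℝ := fun e i b => ∑ k, frame x e k * T i b k with hS
  have e1 : ∀ i j e, ∑ c, frame x c j * ∑ b, frame x c b * S e i b =
      ∑ k, frame x e k * mixed x (T i) j k := fun i j e => by
    rw [← raise_eq_sum_frame]
    simp only [hS, mixed, lowContr, mul_add, Finset.sum_add_distrib, Finset.sum_mul,
      Finset.mul_sum]
    congr 1
    rw [Finset.sum_comm]
    exact Finset.sum_congr rfl fun k _ => Finset.sum_congr rfl fun i _ => by ring
  have e2 : ∀ i j, (∑ k, mixed x (T i) j k * mixed x (T j) i k)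
        + mixedContr x (T i) j * mixedContr x (T j) i =
      ∑ e, (∑ c, frame x c j * ∑ b, frame x c b * S e i b)
        * (∑ c, frame x c i * ∑ b, frame x c b * S e j b) := fun i j => by
    simp only [e1, Fintype.sum_option, frame_some_sum, frame_none_sum, mixedContr]
    simp only [mul_comm (x _) (mixed _ _ _ _)]
    ring
  have e3 : ∑ k, ∑ m, ∑ i, ∑ p, ∑ j, ∑ q, ginv k m x * ginv i p x * ginv j q x *
        T k i j * T m p q = ∑ e, frameNormSq x (S e) := by
    have : ∀ k m i p, ∑ j, ∑ q, ginv k m x * ginv i p x * ginv j q x * T k i j * T m p q =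
        ∑ e, ginv k m x * ginv i p x * S e k i * S e m p := fun k m i p => by
      simp only [mul_assoc (ginv k m x * ginv i p x), ← Finset.mul_sum]
      simp only [sum_ginv_mul]
      rfl
    simp only [this, ← sum_ginv_ginv_mul]
    simp only [Finset.sum_comm (s := Finset.univ (α := Fin n))
      (t := Finset.univ (α := Option (Fin n)))]
  rw [e3]
  simp only [e2]
  rw [Finset.sum_congr rfl fun i _ => Finset.sum_comm, Finset.sum_comm]
  refine Finset.sum_le_sum fun e _ => ?_
  rw [trace_sq_eq_sum_frame]
  exact trace_sq_le_frameNormSq x (S e)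

lemma raised_eq_sum_frame (h : Fin n → Fin n → ℝ) (i k : Fin n) :
    raised x h i k = ∑ d, frame x d k * ∑ c, frame x c i * frameComp x h c d := by
  have : raised x h i k = mixed x h i k + (∑ l, mixed x h i l * x l) * x k := rfl
  rw [this, raise_eq_sum_frame x (fun k => mixed x h i k)]
  refine Finset.sum_congr rfl fun d _ => ?_
  congr 1
  simp only [mixed_eq_sum_frame, frameComp, Finset.mul_sum]
  rw [Finset.sum_comm]
  refine Finset.sum_congr rfl fun c _ => ?_
  rw [Finset.sum_comm]
  exact Finset.sum_congr rfl fun k _ => Finset.sum_congr rfl fun i _ => by ring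

/-- Completing the square in the terms containing the divergence. -/
lemma divergence_terms_nonneg {h : Fin n → Fin n → ℝ} {f : ℝ} (hf : 0 < f)
    {φ δ : Fin n → ℝ} (hφ : ∑ i, φ i ^ 2 + (∑ i, x i * φ i) ^ 2 ≤ f ^ 2) :
    0 ≤ f * (∑ k, δ k ^ 2 + (∑ k, δ k * x k) ^ 2)
      + 2 * ∑ i, φ i * ∑ k, raised x h i k * δ k + f * frameNormSq x h := by
  set a : Option (Fin n) → ℝ := fun c => ∑ i, frame x c i * φ i with ha
  set b : Option (Fin n) → ℝ := fun c => ∑ i, frame x c i * δ i with hb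
  set v : Option (Fin n) → ℝ := fun d => ∑ c, a c * frameComp x h c d with hv
  have ea : ∑ i, φ i ^ 2 + (∑ i, x i * φ i) ^ 2 = ∑ c, a c ^ 2 := by
    simp only [ha, Fintype.sum_option, frame_some_sum, frame_none_sum]; ring
  have eb : ∑ k, δ k ^ 2 + (∑ k, δ k * x k) ^ 2 = ∑ c, b c ^ 2 := by
    simp only [hb, Fintype.sum_option, frame_some_sum, frame_none_sum, mul_comm (x _)]; ring
  have ev : ∑ i, φ i * ∑ k, raised x h i k * δ k = ∑ d, v d * b d := by
    have e1 : ∀ i, ∑ k, raised x h i k * δ k =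
        ∑ d, (∑ c, frame x c i * frameComp x h c d) * b d := fun i => by
      simp only [raised_eq_sum_frame, hb, Finset.sum_mul (s := Finset.univ (α := Option (Fin n)))]
      rw [Finset.sum_comm]
      refine Finset.sum_congr rfl fun d _ => ?_
      rw [← Finset.sum_mul, Finset.mul_sum]
      exact Finset.sum_congr rfl fun k _ => by ring
    simp only [e1, Finset.mul_sum]
    rw [Finset.sum_comm]
    refine Finset.sum_congr rfl fun d _ => ?_
    simp only [← mul_assoc]
    rw [← Finset.sum_mul]
    congr 1
    simp only [hv, ha, Finset.mul_sum, Finset.sum_mul]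
    rw [Finset.sum_comm]
    exact Finset.sum_congr rfl fun k _ => Finset.sum_congr rfl fun i _ => by ring
  have hvle : ∑ d, v d ^ 2 ≤ f ^ 2 * frameNormSq x h := by
    have : ∀ d, v d ^ 2 ≤ f ^ 2 * ∑ c, frameComp x h c d ^ 2 := fun d =>
      (Finset.sum_mul_sq_le_sq_mul_sq _ _ _).trans
        (mul_le_mul_of_nonneg_right (ea ▸ hφ) (by positivity))
    refine (Finset.sum_le_sum fun d _ => this d).trans ?_
    rw [← Finset.mul_sum, frameNormSq, Finset.sum_comm]
  rw [eb, ev]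
  have hsq : 0 ≤ ∑ d, (f * b d + v d) ^ 2 := by positivity
  have e : ∑ d, (f * b d + v d) ^ 2 =
      f * (f * ∑ d, b d ^ 2 + 2 * ∑ d, v d * b d) + ∑ d, v d ^ 2 := by
    simp only [Finset.mul_sum, ← Finset.sum_add_distrib]
    exact Finset.sum_congr rfl fun k _ => by ring
  refine (mul_nonneg_iff_of_pos_left hf).1 ?_
  rw [e] at hsq
  linarith

end Frame

section PartialDerivatives

variable {n : ℕ} {f g : (Fin n → ℝ) → ℝ} {a b : ℝ} {i : Fin n} {x : Fin n → ℝ}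

/-- `f` is differentiable at `x` and its `i`-th partial derivative there is `a`. -/
def HasPd (f : (Fin n → ℝ) → ℝ) (a : ℝ) (i : Fin n) (x : Fin n → ℝ) : Prop :=
  DifferentiableAt ℝ f x ∧ pd f i x = a

lemma HasPd.congr_value (hf : HasPd f a i x) (hab : a = b) : HasPd f b i x := hab ▸ hf

lemma ContDiff.hasPd (hf : ContDiff ℝ (⊤ : ℕ∞) f) (i : Fin n) (x : Fin n → ℝ) :
    HasPd f (pd f i x) i x := ⟨hf.differentiable (by simp) x, rfl⟩

lemma ContDiff.contDiff_pd (hf : ContDiff ℝ (⊤ : ℕ∞) f) (i : Fin n) :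
    ContDiff ℝ (⊤ : ℕ∞) (pd f i) :=
  (hf.fderiv_right (m := ((⊤ : ℕ∞) : WithTop ℕ∞)) (by simp)).clm_apply contDiff_const

lemma hasPd_const (c : ℝ) : HasPd (fun _ => c) 0 i x :=
  ⟨differentiableAt_const c, by simp [pd]⟩

lemma hasPd_coord (j : Fin n) : HasPd (fun y => y j) (if i = j then 1 else 0) i x := by
  have h : HasFDerivAt (fun y : Fin n → ℝ => y j)
    (ContinuousLinearMap.proj (R := ℝ) (φ := fun _ : Fin n => ℝ) j) x := hasFDerivAt_apply j x
  refine ⟨h.differentiableAt, ?_⟩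
  rw [pd, h.fderiv]
  simp [Pi.single_apply, eq_comm]

lemma HasPd.add (hf : HasPd f a i x) (hg : HasPd g b i x) :
    HasPd (fun y => f y + g y) (a + b) i x :=
  ⟨hf.1.fun_add hg.1, by rw [pd, fderiv_fun_add hf.1 hg.1, ← hf.2, ← hg.2]; rfl⟩

lemma HasPd.sub (hf : HasPd f a i x) (hg : HasPd g b i x) :
    HasPd (fun y => f y - g y) (a - b) i x :=
  ⟨hf.1.fun_sub hg.1, by rw [pd, fderiv_fun_sub hf.1 hg.1, ← hf.2, ← hg.2]; rfl⟩

lemma HasPd.mul (hf : HasPd f a i x) (hg : HasPd g b i x) :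
    HasPd (fun y => f y * g y) (a * g x + f x * b) i x :=
  ⟨hf.1.fun_mul hg.1, by
    rw [pd, fderiv_fun_mul hf.1 hg.1, ← hf.2, ← hg.2]
    simp [pd]; ring⟩

lemma HasPd.sum {ι : Type*} [Fintype ι] {F : ι → (Fin n → ℝ) → ℝ} {F' : ι → ℝ}
    (hF : ∀ j, HasPd (F j) (F' j) i x) : HasPd (fun y => ∑ j, F j y) (∑ j, F' j) i x :=
  ⟨DifferentiableAt.fun_sum fun j _ => (hF j).1, by
    rw [pd, fderiv_fun_sum fun j _ => (hF j).1, sum_apply]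
    exact Finset.sum_congr rfl fun j _ => (hF j).2⟩

lemma HasDerivAt.comp_hasPd {F : ℝ → ℝ} (hF : HasDerivAt F b (f x)) (hf : HasPd f a i x) :
    HasPd (fun y => F (f y)) (b * a) i x := by
  have := hF.comp_hasFDerivAt x hf.1.hasFDerivAt
  refine ⟨this.differentiableAt, ?_⟩
  rw [pd, show (fun y => F (f y)) = F ∘ f from rfl, this.fderiv, ← hf.2]
  rfl

/-- Partial derivatives of smooth functions commute. -/
lemma pd_pd_comm (hf : ContDiff ℝ (⊤ : ℕ∞) f) (i j : Fin n) (x : Fin n → ℝ) :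
    pd (pd f j) i x = pd (pd f i) j x := by
  have key : ∀ i j : Fin n, pd (pd f j) i x =
      fderiv ℝ (fderiv ℝ f) x (Pi.single i 1) (Pi.single j 1) := fun i j => by
    have hd : DifferentiableAt ℝ (fderiv ℝ f) x :=
      (hf.fderiv_right (m := ((⊤ : ℕ∞) : WithTop ℕ∞)) (by simp)).differentiable (by simp) x
    rw [pd, show pd f j = fun y => fderiv ℝ f y (Pi.single j 1) from rfl,
      fderiv_clm_apply hd (differentiableAt_const _)]
    simp
  rw [key, key]
  exact hf.contDiffAt.isSymmSndFDerivAt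
    (by simpa using WithTop.coe_le_coe.2 (le_top (a := (2 : ℕ∞)))) _ _

/-- The integral of a partial derivative of a compactly supported function vanishes. -/
lemma integral_pd_eq_zero (hf : ContDiff ℝ (⊤ : ℕ∞) f) (hc : HasCompactSupport f) (i : Fin n) :
    Integrable (pd f i) ∧ ∫ x, pd f i x = 0 := by
  have hc' : HasCompactSupport (pd f i) := hc.fderiv_apply (𝕜 := ℝ) _
  have hi : Integrable (pd f i) :=
    (hf.contDiff_pd i).continuous.integrable_of_hasCompactSupport hc'
  refine ⟨hi, ?_⟩
  have := integral_mul_fderiv_eq_neg_fderiv_mul_of_integrable (𝕜 := ℝ)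
    (μ := (volume : Measure (Fin n → ℝ)))
    (f := fun _ => (1 : ℝ)) (g := f) (v := Pi.single i 1)
    (by simp) (by simpa using! hi)
    (by simpa using hf.continuous.integrable_of_hasCompactSupport hc)
    (fun x _ => differentiableAt_const _) (fun x _ => hf.differentiable (by simp) x)
  simpa [pd] using this

end PartialDerivatives

section HyperbolicMetric

variable {n : ℕ}

/-- The determinant of the hyperbolic metric, `(1 + ‖x‖²)⁻¹`. -/
def metricDet (x : Fin n → ℝ) : ℝ := (1 + ∑ k, x k ^ 2)⁻¹

/-- The hyperbolic volume density, `(1 + ‖x‖²)^{-1/2}`. -/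
def volDensity (x : Fin n → ℝ) : ℝ := (Real.sqrt (1 + ∑ k, x k ^ 2))⁻¹

lemma one_add_sum_sq_pos (x : Fin n → ℝ) : 0 < 1 + ∑ k, x k ^ 2 := by positivity

lemma metricDet_mul (x : Fin n → ℝ) : metricDet x * (1 + ∑ k, x k ^ 2) = 1 :=
  inv_mul_cancel₀ (one_add_sum_sq_pos x).ne'

lemma volDensity_mul_sqrt (x : Fin n → ℝ) :
    volDensity x * Real.sqrt (1 + ∑ k, x k ^ 2) = 1 :=
  inv_mul_cancel₀ (Real.sqrt_pos.2 (one_add_sum_sq_pos x)).ne'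

lemma volDensity_sq (x : Fin n → ℝ) : volDensity x ^ 2 = metricDet x := by
  rw [volDensity, inv_pow, Real.sq_sqrt (one_add_sum_sq_pos x).le, metricDet]

lemma gbar_eq (i j : Fin n) (x : Fin n → ℝ) :
    gbar i j x = (if i = j then 1 else 0) - metricDet x * x i * x j := by
  rw [gbar, metricDet, div_eq_mul_inv]; ring

lemma hasPd_sum_sq (i : Fin n) (x : Fin n → ℝ) :
    HasPd (fun y => 1 + ∑ k, y k ^ 2) (2 * x i) i x := by
  have := (hasPd_const (i := i) (x := x) (1 : ℝ)).add
    (HasPd.sum fun k : Fin n => (hasPd_coord k).mul (hasPd_coord k))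
  simp only [← sq] at this
  refine this.congr_value ?_
  simp [Finset.sum_add_distrib]; ring

lemma hasPd_metricDet (i : Fin n) (x : Fin n → ℝ) :
    HasPd metricDet (-2 * metricDet x ^ 2 * x i) i x := by
  refine ((hasDerivAt_inv (one_add_sum_sq_pos x).ne').comp_hasPd
    (hasPd_sum_sq i x)).congr_value ?_
  rw [metricDet]
  generalize 1 + ∑ k, x k ^ 2 = s
  ring

lemma hasPd_volDensity (i : Fin n) (x : Fin n → ℝ) :
    HasPd volDensity (-volDensity x * metricDet x * x i) i x := by
  have hp := one_add_sum_sq_pos x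
  have hs := Real.sqrt_pos.2 hp
  refine (((Real.hasDerivAt_sqrt hp.ne').inv hs.ne').comp_hasPd
    (hasPd_sum_sq i x)).congr_value ?_
  rw [← volDensity_sq, volDensity]
  field_simp

lemma hasPd_gbar (i j l : Fin n) (x : Fin n → ℝ) :
    HasPd (gbar i j) (2 * metricDet x ^ 2 * x l * x i * x j
      - metricDet x * (if l = i then 1 else 0) * x j
      - metricDet x * x i * (if l = j then 1 else 0)) l x := by
  have := (hasPd_const (i := l) (x := x) (if i = j then (1 : ℝ) else 0)).sub
    (((hasPd_metricDet l x).mul (hasPd_coord i)).mul (hasPd_coord j))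
  simp only [← gbar_eq] at this
  exact this.congr_value (by ring)

lemma Gam_eq (k i j : Fin n) (x : Fin n → ℝ) : Gam k i j x = -x k * gbar i j x := by
  have e : ∀ l, pd (gbar j l) i x + pd (gbar i l) j x - pd (gbar i j) l x =
      -2 * metricDet x * gbar i j x * x l := fun l => by
    rw [(hasPd_gbar j l i x).2, (hasPd_gbar i l j x).2, (hasPd_gbar i j l x).2, gbar_eq]
    simp only [eq_comm (a := l), eq_comm (a := j) (b := i)]
    ring
  have e2 : ∑ l, ginv k l x * x l = x k * (1 + ∑ k, x k ^ 2) := by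
    simp only [ginv, add_mul, ite_mul, one_mul, zero_mul, Finset.sum_add_distrib,
      Finset.sum_ite_eq, Finset.mem_univ, if_true, mul_add, mul_one, Finset.mul_sum]
    congr 1
    exact Finset.sum_congr rfl fun l _ => by ring
  have e3 : ∑ l, ginv k l x * (-2 * metricDet x * gbar i j x * x l) =
      -2 * metricDet x * gbar i j x * ∑ l, ginv k l x * x l := by
    rw [Finset.mul_sum]
    exact Finset.sum_congr rfl fun l _ => by ring
  simp only [Gam, e, e3, e2]
  linear_combination (-x k * gbar i j x) * metricDet_mul x

lemma contDiff_volDensity : ContDiff ℝ (⊤ : ℕ∞) (volDensity (n := n)) := by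
  unfold volDensity
  refine ContDiff.inv (ContDiff.sqrt (by fun_prop) fun x => (one_add_sum_sq_pos x).ne')
    fun x => (Real.sqrt_pos.2 (one_add_sum_sq_pos x)).ne'

end HyperbolicMetric

section Potential

variable {n : ℕ} (A0 : ℝ) (A : Fin n → ℝ)

/-- The static potential times the hyperbolic volume density. -/
def weight (x : Fin n → ℝ) : ℝ := A0 + volDensity x * ∑ i, A i * x i

/-- The Euclidean gradient of the static potential times the hyperbolic volume density. -/
def weightGrad (j : Fin n) (x : Fin n → ℝ) : ℝ := A0 * metricDet x * x j + volDensity x * A j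

lemma Vpot_mul_volDensity (x : Fin n → ℝ) : Vpot A0 A x * volDensity x = weight A0 A x := by
  rw [Vpot, weight]; linear_combination A0 * volDensity_mul_sqrt x

lemma metricDet_mul_eq (x : Fin n → ℝ) :
    A0 * metricDet x = weight A0 A x - ∑ i, x i * weightGrad A0 A i x := by
  have : ∑ i, x i * weightGrad A0 A i x =
      A0 * metricDet x * ∑ i, x i ^ 2 + volDensity x * ∑ i, A i * x i := by
    simp only [weightGrad, mul_add, Finset.sum_add_distrib, Finset.mul_sum]
    congr 1 <;> exact Finset.sum_congr rfl fun i _ => by ring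
  rw [this, weight]
  linear_combination A0 * metricDet_mul x

lemma hasPd_weight (i : Fin n) (x : Fin n → ℝ) :
    HasPd (weight A0 A) (weightGrad A0 A i x - metricDet x * weight A0 A x * x i) i x := by
  refine ((hasPd_const A0).add ((hasPd_volDensity i x).mul
    (HasPd.sum fun j => (hasPd_const (A j)).mul (hasPd_coord j)))).congr_value ?_
  simp [weightGrad, weight]
  ring

lemma hasPd_weightGrad (i j : Fin n) (x : Fin n → ℝ) :
    HasPd (weightGrad A0 A j)
      (A0 * metricDet x * gbar i j x - metricDet x * x i * weightGrad A0 A j x) i x := by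
  refine ((((hasPd_const A0).mul (hasPd_metricDet i x)).mul (hasPd_coord j)).add
    ((hasPd_volDensity i x).mul (hasPd_const (A j)))).congr_value ?_
  rw [gbar_eq, weightGrad]
  ring

lemma contDiff_weight : ContDiff ℝ (⊤ : ℕ∞) (weight A0 A) :=
  contDiff_const.add (contDiff_volDensity.mul (by fun_prop))

lemma contDiff_weightGrad (j : Fin n) : ContDiff ℝ (⊤ : ℕ∞) (weightGrad A0 A j) := by
  have h : ContDiff ℝ (⊤ : ℕ∞) (metricDet (n := n)) := by
    simpa only [volDensity_sq] using! (contDiff_volDensity (n := n)).pow 2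
  unfold weightGrad
  exact ((contDiff_const.mul h).mul (contDiff_apply ℝ ℝ j)).add
    (contDiff_volDensity.mul contDiff_const)

variable {A0 A}

lemma weight_pos (hA0 : 0 < A0) (hA : Real.sqrt (∑ i, A i ^ 2) ≤ A0) (x : Fin n → ℝ) :
    0 < weight A0 A x := by
  have hρ : 0 < volDensity x := inv_pos.2 (Real.sqrt_pos.2 (one_add_sum_sq_pos x))
  rw [← Vpot_mul_volDensity, Vpot]
  refine mul_pos ?_ hρ
  have hA2 : ∑ i, A i ^ 2 ≤ A0 ^ 2 := (Real.sqrt_le_left hA0.le).1 hA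
  have h1 : |∑ i, A i * x i| < A0 * Real.sqrt (1 + ∑ k, x k ^ 2) := by
    refine abs_lt_of_sq_lt_sq ?_ (by positivity)
    rw [mul_pow, Real.sq_sqrt (one_add_sum_sq_pos x).le]
    have h2 := Finset.sum_mul_sq_le_sq_mul_sq Finset.univ A x
    have h3 : 0 ≤ ∑ k, x k ^ 2 := by positivity
    nlinarith [mul_le_mul_of_nonneg_right hA2 h3, sq_pos_of_pos hA0]
  linarith [(abs_lt.1 h1).1]

lemma weightGrad_sq_le (hA0 : 0 < A0) (hA : Real.sqrt (∑ i, A i ^ 2) ≤ A0) (x : Fin n → ℝ) :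
    ∑ i, weightGrad A0 A i x ^ 2 + (∑ i, x i * weightGrad A0 A i x) ^ 2 ≤
      weight A0 A x ^ 2 := by
  have hA2 : ∑ i, A i ^ 2 ≤ A0 ^ 2 := (Real.sqrt_le_left hA0.le).1 hA
  have h1 : ∑ i, x i * weightGrad A0 A i x = weight A0 A x - A0 * metricDet x := by
    rw [metricDet_mul_eq A0 A]; ring
  have h2 : ∑ i, weightGrad A0 A i x ^ 2 = A0 ^ 2 * metricDet x ^ 2 * ∑ i, x i ^ 2 +
      2 * A0 * metricDet x * volDensity x * ∑ i, A i * x i +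
        metricDet x * ∑ i, A i ^ 2 := by
    simp only [weightGrad, ← volDensity_sq, Finset.mul_sum, ← Finset.sum_add_distrib]
    exact Finset.sum_congr rfl fun i _ => by ring
  have h3 : 0 < metricDet x := inv_pos.2 (one_add_sum_sq_pos x)
  rw [h1, h2, weight]
  have h4 := metricDet_mul x
  have h5 : A0 ^ 2 * metricDet x ^ 2 * ∑ i, x i ^ 2 =
      A0 ^ 2 * metricDet x - A0 ^ 2 * metricDet x ^ 2 := by
    linear_combination A0 ^ 2 * metricDet x * h4
  nlinarith [mul_le_mul_of_nonneg_left hA2 h3.le]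

end Potential

section TensorFields

variable {n : ℕ} {h : Fin n → Fin n → (Fin n → ℝ) → ℝ}

/-- The value of a 2-tensor field at a point. -/
def tensorAt (h : Fin n → Fin n → (Fin n → ℝ) → ℝ) (x : Fin n → ℝ) (a b : Fin n) : ℝ :=
  h a b x

/-- The components of a 2-tensor field with its first index raised. -/
def mixedField (h : Fin n → Fin n → (Fin n → ℝ) → ℝ) (i k : Fin n) (x : Fin n → ℝ) : ℝ :=
  mixed x (tensorAt h x) i k

/-- The components of a 2-tensor field with both indices raised. -/
def raisedField (h : Fin n → Fin n → (Fin n → ℝ) → ℝ) (i k : Fin n) (x : Fin n → ℝ) : ℝ :=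
  raised x (tensorAt h x) i k

/-- The trace of the square of a 2-tensor field. -/
def traceSq (h : Fin n → Fin n → (Fin n → ℝ) → ℝ) (x : Fin n → ℝ) : ℝ :=
  ∑ a, ∑ b, mixedField h a b x * mixedField h b a x

/-- The vector field whose Euclidean divergence is the difference between the two sides of the
weighted Poincaré inequality and a nonnegative quantity. -/
def poincareField (A0 : ℝ) (A : Fin n → ℝ) (h : Fin n → Fin n → (Fin n → ℝ) → ℝ) (i : Fin n)
    (x : Fin n → ℝ) : ℝ :=
  weight A0 A x * (∑ j, ∑ k, raisedField h j k x * pd (mixedField h i k) j x -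
      ∑ k, raisedField h i k x * ∑ j, pd (mixedField h j k) j x) -
    (weight A0 A x * traceSq h x * x i +
      ∑ j, ∑ k, raisedField h i k x * mixedField h j k x * weightGrad A0 A j x)

lemma contDiff_mixedField (hsmooth : ∀ i j, ContDiff ℝ (⊤ : ℕ∞) (h i j)) (i k : Fin n) :
    ContDiff ℝ (⊤ : ℕ∞) (mixedField h i k) := by
  unfold mixedField mixed lowContr tensorAt
  fun_prop

lemma contDiff_raisedField (hsmooth : ∀ i j, ContDiff ℝ (⊤ : ℕ∞) (h i j)) (i k : Fin n) :
    ContDiff ℝ (⊤ : ℕ∞) (raisedField h i k) := by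
  unfold raisedField raised mixedContr mixed lowContr tensorAt
  fun_prop

lemma contDiff_poincareField (A0 : ℝ) (A : Fin n → ℝ)
    (hsmooth : ∀ i j, ContDiff ℝ (⊤ : ℕ∞) (h i j)) (i : Fin n) :
    ContDiff ℝ (⊤ : ℕ∞) (poincareField A0 A h i) := by
  have hM := contDiff_mixedField hsmooth
  have hH := contDiff_raisedField hsmooth
  have hP := fun a b j => (hM a b).contDiff_pd j
  have hf := contDiff_weight A0 A
  have hφ := contDiff_weightGrad A0 A
  unfold poincareField traceSq
  fun_prop

lemma covDh_eq (hsymm : ∀ i j x, h i j x = h j i x) (k i j : Fin n) (x : Fin n → ℝ) :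
    covDh h k i j x = pd (h i j) k x + gbar k i x * lowContr x (tensorAt h x) j +
      gbar k j x * lowContr x (tensorAt h x) i := by
  simp only [covDh, Gam_eq, lowContr, tensorAt, Finset.mul_sum, sub_eq_add_neg, add_assoc,
    ← Finset.sum_add_distrib, ← Finset.sum_neg_distrib]
  congr 1
  exact Finset.sum_congr rfl fun l _ => by rw [hsymm i l]; ring

lemma covDh_symm (hsymm : ∀ i j x, h i j x = h j i x) (k i j : Fin n) (x : Fin n → ℝ) :
    covDh h k i j x = covDh h k j i x := by
  have : h i j = h j i := funext (hsymm i j)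
  rw [covDh_eq hsymm, covDh_eq hsymm, this]; ring

lemma hasPd_mixedField (hsmooth : ∀ i j, ContDiff ℝ (⊤ : ℕ∞) (h i j))
    (hsymm : ∀ i j x, h i j x = h j i x) (j i k : Fin n) (x : Fin n → ℝ) :
    HasPd (mixedField h i k) (mixed x (fun a b => covDh h j a b x) i k + x i * h j k x -
      gbar j k x * mixedContr x (tensorAt h x) i) j x := by
  have h1 := ((hsmooth i k).hasPd j x).add ((hasPd_coord i).mul
    (HasPd.sum fun a => (hasPd_coord a).mul ((hsmooth a k).hasPd j x)))
  refine h1.congr_value ?_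
  have hs : ∀ i j, tensorAt h x i j = tensorAt h x j i := fun i j => hsymm i j x
  have e : ∑ a, x a * covDh h j a k x = ∑ a, x a * pd (h a k) j x +
      (∑ a, gbar j a x * x a) * lowContr x (tensorAt h x) k +
      gbar j k x * ∑ a, lowContr x (tensorAt h x) a * x a := by
    simp only [Finset.sum_mul, Finset.mul_sum, ← Finset.sum_add_distrib]
    exact Finset.sum_congr rfl fun a _ => by rw [covDh_eq hsymm]; ring
  have e2 : ∑ a, gbar j a x * x a = metricDet x * x j := by
    have := sum_metric_mul (g := fun i j => gbar i j x) (fun i j => gbar_eq i j x) x j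
    simp only [← sq] at this
    rw [this]; linear_combination (-x j) * metricDet_mul x
  rw [mixedContr_eq hs]
  simp only [mixed]
  rw [lowContr, e, e2, covDh_eq hsymm, gbar_eq j i]
  simp only [lowContr, tensorAt, Finset.sum_add_distrib, ite_mul, one_mul, zero_mul,
    Finset.sum_ite_eq, Finset.mem_univ, if_true]
  split_ifs <;> ring

lemma hasPd_raisedField (hsmooth : ∀ i j, ContDiff ℝ (⊤ : ℕ∞) (h i j)) (i j k : Fin n)
    (x : Fin n → ℝ) :
    HasPd (raisedField h j k) (pd (mixedField h j k) i x +
      (mixedField h j i x + ∑ l, pd (mixedField h j l) i x * x l) * x k +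
        mixedContr x (tensorAt h x) j * if i = k then 1 else 0) i x := by
  have hM := fun a b => (contDiff_mixedField hsmooth a b).hasPd i x
  refine ((hM j k).add ((HasPd.sum fun l => (hM j l).mul (hasPd_coord l)).mul
    (hasPd_coord k))).congr_value ?_
  simp [Finset.sum_add_distrib, mixedContr, mixedField]
  ring

lemma sum_mixedField_self (hsymm : ∀ i j x, h i j x = h j i x)
    (htracefree : ∀ x, (∑ i, ∑ j, ginv i j x * h i j x) = 0) (x : Fin n → ℝ) :
    ∑ i, mixedField h i i x = 0 := by
  rw [← htracefree x]
  refine Finset.sum_congr rfl fun i _ => ?_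
  simp only [mixedField, mixed, lowContr, tensorAt, ginv, add_mul, Finset.sum_add_distrib,
    ite_mul, one_mul, zero_mul, Finset.sum_ite_eq, Finset.mem_univ, if_true, Finset.mul_sum]
  congr 1
  exact Finset.sum_congr rfl fun l _ => by rw [hsymm i l]; ring

lemma sum_pd_mixedField_self (hsmooth : ∀ i j, ContDiff ℝ (⊤ : ℕ∞) (h i j))
    (hsymm : ∀ i j x, h i j x = h j i x)
    (htracefree : ∀ x, (∑ i, ∑ j, ginv i j x * h i j x) = 0) (j : Fin n) (x : Fin n → ℝ) :
    ∑ i, pd (mixedField h i i) j x = 0 := by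
  rw [← (HasPd.sum fun i => (contDiff_mixedField hsmooth i i).hasPd j x).2]
  simp only [sum_mixedField_self hsymm htracefree]
  exact (hasPd_const 0).2

lemma sum_pd_poincareField (A0 : ℝ) (A : Fin n → ℝ)
    (hsmooth : ∀ i j, ContDiff ℝ (⊤ : ℕ∞) (h i j))
    (hsymm : ∀ i j x, h i j x = h j i x)
    (htracefree : ∀ x, (∑ i, ∑ j, ginv i j x * h i j x) = 0) (x : Fin n → ℝ) :
    ∑ i, pd (poincareField A0 A h i) i x =
      weight A0 A x * (∑ i, ∑ j,
        ((∑ k, mixed x (fun a b => covDh h i a b x) j k *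
            mixed x (fun a b => covDh h j a b x) i k) +
          mixedContr x (fun a b => covDh h i a b x) j *
            mixedContr x (fun a b => covDh h j a b x) i) -
        (∑ k, (∑ j, pd (mixedField h j k) j x) ^ 2 +
          (∑ k, (∑ j, pd (mixedField h j k) j x) * x k) ^ 2)) -
      (n + 1) * weight A0 A x * traceSq h x -
      2 * ∑ i, weightGrad A0 A i x * ∑ k, raised x (tensorAt h x) i k *
        ∑ j, pd (mixedField h j k) j x := by
  rw [← weitzenbock_pointwise (h := tensorAt h x) (g := fun i j => gbar i j x)
    (T := fun j a b => covDh h j a b x) (P := fun j i k => pd (mixedField h i k) j x)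
    (dH := fun i j k => pd (raisedField h j k) i x)
    (dN := fun i => pd (traceSq h) i x)
    (B := A0 * metricDet x)
    (fun i j => gbar_eq i j x) (metricDet_mul x) (fun i j => hsymm i j x)
    (fun j a k => covDh_symm hsymm j a k x)
    (fun j i k => (hasPd_mixedField hsmooth hsymm j i k x).2)
    (sum_mixedField_self hsymm htracefree x)
    (fun j => sum_pd_mixedField_self hsmooth hsymm htracefree j x)
    (fun i j k => (hasPd_raisedField hsmooth i j k x).2)
    (fun i => (HasPd.sum fun a => HasPd.sum fun b =>
      ((contDiff_mixedField hsmooth a b).hasPd i x).mul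
        ((contDiff_mixedField hsmooth b a).hasPd i x)).2)
    (N := traceSq h x) rfl (metricDet_mul_eq A0 A x)]
  have hM := fun a b i => (contDiff_mixedField hsmooth a b).hasPd i x
  have hH := fun a b i => (contDiff_raisedField hsmooth a b).hasPd i x
  have hP := fun a b j i => ((contDiff_mixedField hsmooth a b).contDiff_pd j).hasPd i x
  have hN : ∀ i, HasPd (traceSq h) (pd (traceSq h) i x) i x := fun i =>
    ⟨(HasPd.sum fun a => HasPd.sum fun b => (hM a b i).mul (hM b a i)).1, rfl⟩
  have hf := fun i => hasPd_weight A0 A i x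
  have hφ := fun i j => hasPd_weightGrad A0 A i j x
  have key : ∀ i, pd (poincareField A0 A h i) i x =
      weight A0 A x * (∑ j, ∑ k, pd (raisedField h j k) i x * pd (mixedField h i k) j x -
        ∑ k, pd (raisedField h i k) i x * ∑ j, pd (mixedField h j k) j x) +
      weight A0 A x * (∑ j, ∑ k, raisedField h j k x * pd (pd (mixedField h i k) j) i x -
        ∑ k, raisedField h i k x * ∑ j, pd (pd (mixedField h j k) j) i x) +
      (weightGrad A0 A i x - metricDet x * weight A0 A x * x i) *
        (∑ j, ∑ k, raisedField h j k x * pd (mixedField h i k) j x -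
          ∑ k, raisedField h i k x * ∑ j, pd (mixedField h j k) j x) -
      ((weightGrad A0 A i x - metricDet x * weight A0 A x * x i) * traceSq h x * x i +
        weight A0 A x * pd (traceSq h) i x * x i + weight A0 A x * traceSq h x +
        ∑ j, ∑ k, ((pd (raisedField h i k) i x * mixedField h j k x +
          raisedField h i k x * pd (mixedField h j k) i x) * weightGrad A0 A j x +
          raisedField h i k x * mixedField h j k x *
            (A0 * metricDet x * gbar i j x - metricDet x * x i * weightGrad A0 A j x))) :=
    fun i => by
      rw [show pd (poincareField A0 A h i) i x = _ from
        (((hf i).mul ((HasPd.sum fun j => HasPd.sum fun k => (hH j k i).mul (hP i k j i)).sub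
          (HasPd.sum fun k => (hH i k i).mul (HasPd.sum fun j => hP j k j i)))).sub
          ((((hf i).mul (hN i)).mul (hasPd_coord i)).add
            (HasPd.sum fun j => HasPd.sum fun k =>
              ((hH i k i).mul (hM j k i)).mul (hφ i j)))).2]
      simp only [Finset.sum_add_distrib, if_true]
      ring
  have first : ∑ i, ∑ k, pd (raisedField h i k) i x * ∑ j, pd (mixedField h j k) j x =
      ∑ k, (∑ i, pd (raisedField h i k) i x) * ∑ j, pd (mixedField h j k) j x := by
    rw [Finset.sum_comm]
    simp only [Finset.sum_mul]
  have second : ∑ i, ∑ j, ∑ k, raisedField h j k x * pd (pd (mixedField h i k) j) i x =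
      ∑ i, ∑ k, raisedField h i k x * ∑ j, pd (pd (mixedField h j k) j) i x := by
    rw [Finset.sum_comm]
    refine Finset.sum_congr rfl fun i _ => ?_
    rw [Finset.sum_comm]
    refine Finset.sum_congr rfl fun k _ => ?_
    rw [Finset.mul_sum]
    exact Finset.sum_congr rfl fun j _ => by rw [pd_pd_comm (contDiff_mixedField hsmooth j k)]
  rw [Finset.sum_congr rfl fun i _ => key i, Finset.sum_sub_distrib, Finset.sum_add_distrib,
    Finset.sum_add_distrib, ← Finset.mul_sum, ← Finset.mul_sum, Finset.sum_sub_distrib,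
    Finset.sum_sub_distrib, first, second, sub_self, mul_zero, add_zero]
  rfl

end TensorFields

section Integration

variable {n : ℕ} {h : Fin n → Fin n → (Fin n → ℝ) → ℝ}

/-- The pointwise form of the weighted Poincaré inequality, up to a divergence. -/
lemma hNormSq_mul_weight_le {A0 : ℝ} {A : Fin n → ℝ} (hA0 : 0 < A0)
    (hA : Real.sqrt (∑ i, A i ^ 2) ≤ A0)
    (hsmooth : ∀ i j, ContDiff ℝ (⊤ : ℕ∞) (h i j))
    (hsymm : ∀ i j x, h i j x = h j i x)
    (htracefree : ∀ x, (∑ i, ∑ j, ginv i j x * h i j x) = 0) (x : Fin n → ℝ) :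
    n * (hNormSq h x * weight A0 A x) + ∑ i, pd (poincareField A0 A h i) i x ≤
      covDNormSq h x * weight A0 A x := by
  have hf := weight_pos hA0 hA x
  have hN : hNormSq h x = frameNormSq x (tensorAt h x) := sum_ginv_ginv_mul x (tensorAt h x)
  have hN' : traceSq h x = frameNormSq x (tensorAt h x) :=
    sum_mixed_mul_mixed x fun i j => hsymm i j x
  have hT := mul_le_mul_of_nonneg_left (transposed_square_le x fun k i j => covDh h k i j x) hf.le
  have hδ := divergence_terms_nonneg x (h := tensorAt h x)
    (δ := fun k => ∑ j, pd (mixedField h j k) j x) hf (weightGrad_sq_le hA0 hA x)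
  rw [sum_pd_poincareField A0 A hsmooth hsymm htracefree, hN, hN']
  change _ ≤ weight A0 A x * covDNormSq h x at hT
  linarith

/-- The support of a tensor field, as the union of the supports of its components. -/
def fieldSupport (h : Fin n → Fin n → (Fin n → ℝ) → ℝ) : Set (Fin n → ℝ) :=
  ⋃ i, ⋃ j, tsupport (h i j)

lemma isCompact_fieldSupport (hsupp : ∀ i j, HasCompactSupport (h i j)) :
    IsCompact (fieldSupport h) :=
  isCompact_iUnion fun i => isCompact_iUnion fun j => hsupp i j

lemma eq_zero_of_notMem_fieldSupport {x : Fin n → ℝ} (hx : x ∉ fieldSupport h) (i j : Fin n) :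
    h i j x = 0 := by
  simp only [fieldSupport, Set.mem_iUnion, not_exists] at hx
  exact image_eq_zero_of_notMem_tsupport (hx i j)

lemma pd_eq_zero_of_notMem_fieldSupport {x : Fin n → ℝ} (hx : x ∉ fieldSupport h)
    (i j k : Fin n) : pd (h i j) k x = 0 := by
  simp only [fieldSupport, Set.mem_iUnion, not_exists] at hx
  exact image_eq_zero_of_notMem_tsupport fun hx' =>
    hx i j (tsupport_fderiv_apply_subset ℝ (Pi.single k 1) hx')

lemma hasCompactSupport_poincareField (A0 : ℝ) (A : Fin n → ℝ)
    (hsupp : ∀ i j, HasCompactSupport (h i j)) (i : Fin n) :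
    HasCompactSupport (poincareField A0 A h i) := by
  refine HasCompactSupport.intro (isCompact_fieldSupport hsupp) fun x hx => ?_
  have h0 := eq_zero_of_notMem_fieldSupport hx
  simp [poincareField, traceSq, raisedField, mixedField, raised, mixedContr, mixed, lowContr,
    tensorAt, h0]

lemma integrable_hNormSq_mul_weight (A0 : ℝ) (A : Fin n → ℝ)
    (hsmooth : ∀ i j, ContDiff ℝ (⊤ : ℕ∞) (h i j))
    (hsupp : ∀ i j, HasCompactSupport (h i j)) :
    Integrable fun x => hNormSq h x * weight A0 A x := by
  refine Continuous.integrable_of_hasCompactSupport ?_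
    (HasCompactSupport.intro (isCompact_fieldSupport hsupp) fun x hx => ?_)
  · have hc := fun i j => (hsmooth i j).continuous
    have hf := (contDiff_weight A0 A).continuous
    unfold hNormSq ginv
    fun_prop
  · simp [hNormSq, eq_zero_of_notMem_fieldSupport hx]

lemma integrable_covDNormSq_mul_weight (A0 : ℝ) (A : Fin n → ℝ)
    (hsmooth : ∀ i j, ContDiff ℝ (⊤ : ℕ∞) (h i j))
    (hsupp : ∀ i j, HasCompactSupport (h i j)) :
    Integrable fun x => covDNormSq h x * weight A0 A x := by
  refine Continuous.integrable_of_hasCompactSupport ?_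
    (HasCompactSupport.intro (isCompact_fieldSupport hsupp) fun x hx => ?_)
  · have hc := fun i j => (hsmooth i j).continuous
    have hd := fun i j k => ((hsmooth i j).contDiff_pd k).continuous
    have hf := (contDiff_weight A0 A).continuous
    have hg : ∀ i j : Fin n, Continuous (gbar i j) := fun i j => by
      unfold gbar
      exact continuous_const.sub (Continuous.div (by fun_prop) (by fun_prop)
        fun x => (one_add_sum_sq_pos x).ne')
    have hD : ∀ k i j, Continuous (covDh h k i j) := fun k i j => by
      unfold covDh
      simp only [Gam_eq]
      fun_prop
    unfold covDNormSq ginv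
    fun_prop
  · simp [covDNormSq, covDh, eq_zero_of_notMem_fieldSupport hx,
      pd_eq_zero_of_notMem_fieldSupport hx]

end Integration

/-- the weighted Poincaré inequality
`∫ |ĥ|²_ḡ V dμ ≤ (1/n) ∫ |∇̄ĥ|²_ḡ V dμ` on hyperbolic space, for smooth compactly
supported `ḡ`-trace-free symmetric 2-tensors, with `dμ = (1+‖x‖²)^{−1/2} dx`. -/
theorem weighted_poincare_inequality (n : ℕ) (hn : 2 ≤ n)
    (A0 : ℝ) (hA0 : 0 < A0) (A : Fin n → ℝ) (hA : Real.sqrt (∑ i, A i ^ 2) ≤ A0)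
    (h : Fin n → Fin n → (Fin n → ℝ) → ℝ)
    (hsmooth : ∀ i j, ContDiff ℝ (⊤ : ℕ∞) (h i j))
    (hsupp : ∀ i j, HasCompactSupport (h i j))
    (hsymm : ∀ i j x, h i j x = h j i x)
    (htracefree : ∀ x, (∑ i, ∑ j, ginv i j x * h i j x) = 0) :
    (∫ x : Fin n → ℝ,
        hNormSq h x * Vpot A0 A x * (Real.sqrt (1 + ∑ k, x k ^ 2))⁻¹)
      ≤ (1 / (n : ℝ)) * ∫ x : Fin n → ℝ,
          covDNormSq h x * Vpot A0 A x * (Real.sqrt (1 + ∑ k, x k ^ 2))⁻¹ := by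
  have hw : ∀ F : (Fin n → ℝ) → ℝ,
      (∫ x : Fin n → ℝ, F x * Vpot A0 A x * (Real.sqrt (1 + ∑ k, x k ^ 2))⁻¹) =
        ∫ x : Fin n → ℝ, F x * weight A0 A x := fun F => by
    refine integral_congr_ae (.of_forall fun x => ?_)
    simp only [← Vpot_mul_volDensity, volDensity, mul_assoc]
  rw [hw, hw]
  have hi := integrable_hNormSq_mul_weight A0 A hsmooth hsupp
  have hd := fun i : Fin n => integral_pd_eq_zero (contDiff_poincareField A0 A hsmooth i)
    (hasCompactSupport_poincareField A0 A hsupp i) i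
  have hs : Integrable fun x : Fin n → ℝ => ∑ i, pd (poincareField A0 A h i) i x :=
    integrable_finsetSum _ fun i _ => (hd i).1
  have hle := integral_mono ((hi.const_mul (n : ℝ)).add hs)
    (integrable_covDNormSq_mul_weight A0 A hsmooth hsupp)
    (hNormSq_mul_weight_le hA0 hA hsmooth hsymm htracefree)
  rw [integral_add' (hi.const_mul _) hs, integral_const_mul,
    integral_finsetSum _ fun i _ => (hd i).1,
    Finset.sum_eq_zero fun i _ => (hd i).2, add_zero] at hle
  have hn' : (0 : ℝ) < n := by positivity
  rw [one_div, inv_mul_eq_div, le_div_iff₀ hn', mul_comm]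
  exact hle
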